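/- Fix an integer n ≥ 3. Let U be the real symmetric matrix defined as follows. Its index set is I₁ ⊔ I₂ ⊔ I₃, where I₁ = {(T,ℓ) : T a 3-element subset of {1,…,n}, ℓ ∈ T}, I₂ = {(i,j) : i,j ∈ {1,…,n}, i ≠ j}, and I₃ = {1,…,n} × {1,…,n} with elements written (î,ĵ). Using Iverson brackets [P] ∈ {0,1}, the entries of U are: for (T,ℓ), (T′,ℓ′) ∈ I₁: 6(|T ∩ T′| + [ℓ = ℓ′]); for (i,j), (i′,j′) ∈ I₂: 6[j = j′] + 30[i = i′] + 12[i = j′] + 12[j = i′]; for (î,ĵ), (î′,ĵ′) ∈ I₃: 3(|{î,ĵ} ∩ {î′,ĵ′}| + [î = î′]) if î ≠ ĵ and î′ ≠ ĵ′, and 3(3[î = î′] + 2[ĵ = ĵ′]) if î = ĵ or î′ = ĵ′; for (T,ℓ) ∈ I₁ and (i′,j′) ∈ I₂: 12[i′ ∈ T] + 6[j′ ∈ T] + 6[i′ = ℓ]; for (T,ℓ) ∈ I₁ and (î,ĵ) ∈ I₃: 6[î ∈ T] + 3[ĵ ∈ T] + 3[ĵ = ℓ]; for (i,j) ∈ I₂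 and (î,ĵ) ∈ I₃: 15 if i = î and j = ĵ; otherwise 21 if i = î and i = ĵ; otherwise 12 if i = î and j ≠ î and i ≠ ĵ; otherwise 15 if j = î and i = ĵ; otherwise 9 if i = ĵ and j ≠ î and i ≠ î; otherwise 9 if î = ĵ and j = î; otherwise 6 if j = î and i ≠ ĵ and j ≠ ĵ; otherwise 3 if j = ĵ and î ≠ ĵ; otherwise 0; and the entries with row index in a later block than the column index are given by symmetry. Let v be the vector (indexed by I₁ ⊔ I₂ ⊔ I₃) whose coordinates equal 1 at every index in I₁, 1 at every index in I₂, and 1/2 at every index in I₃. Then U·v = 15n(2n−1)·v; that is, v is an eigenvector of U with eigenvalue d = 15n(2n−1). -/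

import Mathlib

open Matrix

/-- Iverson bracket. -/
noncomputable def iv (P : Prop) [Decidable P] : ℝ := if P then 1 else 0

/-- Index block 1: pairs (T, ℓ) with T a 3-element subset and ℓ ∈ T. -/
abbrev I1 (n : ℕ) := {p : Finset (Fin n) × Fin n // p.1.card = 3 ∧ p.2 ∈ p.1}
/-- Index block 2: pairs (i, j) with i ≠ j. -/
abbrev I2 (n : ℕ) := {p : Fin n × Fin n // p.1 ≠ p.2}
/-- Index block 3: all pairs (î, ĵ). -/
abbrev I3 (n : ℕ) := Fin n × Fin n
/-- Full index set of the matrix U. -/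
abbrev Idx (n : ℕ) := I1 n ⊕ I2 n ⊕ I3 n

noncomputable def u11 {n : ℕ} (T : Finset (Fin n)) (l : Fin n) (T' : Finset (Fin n)) (l' : Fin n) : ℝ :=
  6 * (((T ∩ T').card : ℝ) + iv (l = l'))

noncomputable def u22 {n : ℕ} (i j i' j' : Fin n) : ℝ :=
  6 * iv (j = j') + 30 * iv (i = i') + 12 * iv (i = j') + 12 * iv (j = i')

noncomputable def u33 {n : ℕ} (i j i' j' : Fin n) : ℝ :=
  if i ≠ j ∧ i' ≠ j' then
    3 * (((({i, j} : Finset (Fin n)) ∩ ({i', j'} : Finset (Fin n))).card : ℝ) + iv (i = i'))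
  else
    3 * (3 * iv (i = i') + 2 * iv (j = j'))

noncomputable def u12 {n : ℕ} (T : Finset (Fin n)) (l : Fin n) (i' j' : Fin n) : ℝ :=
  12 * iv (i' ∈ T) + 6 * iv (j' ∈ T) + 6 * iv (i' = l)

noncomputable def u13 {n : ℕ} (T : Finset (Fin n)) (l : Fin n) (i' j' : Fin n) : ℝ :=
  6 * iv (i' ∈ T) + 3 * iv (j' ∈ T) + 3 * iv (j' = l)

noncomputable def u23 {n : ℕ} (i j i' j' : Fin n) : ℝ :=
  if i = i' ∧ j = j' then 15
  else if i = i' ∧ i = j' then 21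
  else if i = i' ∧ j ≠ i' ∧ i ≠ j' then 12
  else if j = i' ∧ i = j' then 15
  else if i = j' ∧ j ≠ i' ∧ i ≠ i' then 9
  else if i' = j' ∧ j = i' then 9
  else if j = i' ∧ i ≠ j' ∧ j ≠ j' then 6
  else if j = j' ∧ i' ≠ j' then 3
  else 0

/-- The Gram matrix U of the paper. -/
noncomputable def matU (n : ℕ) : Matrix (Idx n) (Idx n) ℝ :=
  Matrix.of fun x y =>
    match x, y with
    | .inl a, .inl b => u11 a.1.1 a.1.2 b.1.1 b.1.2
    | .inl a, .inr (.inl b) => u12 a.1.1 a.1.2 b.1.1 b.1.2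
    | .inl a, .inr (.inr b) => u13 a.1.1 a.1.2 b.1 b.2
    | .inr (.inl a), .inl b => u12 b.1.1 b.1.2 a.1.1 a.1.2
    | .inr (.inl a), .inr (.inl b) => u22 a.1.1 a.1.2 b.1.1 b.1.2
    | .inr (.inl a), .inr (.inr b) => u23 a.1.1 a.1.2 b.1 b.2
    | .inr (.inr a), .inl b => u13 b.1.1 b.1.2 a.1 a.2
    | .inr (.inr a), .inr (.inl b) => u23 b.1.1 b.1.2 a.1 a.2
    | .inr (.inr a), .inr (.inr b) => u33 a.1 a.2 b.1 b.2


/-- The vector with coordinates 1 on index blocks 1 and 2, and 1/2 on index block 3. -/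
noncomputable def vEig (n : ℕ) : Idx n → ℝ := fun x =>
  match x with
  | .inl _ => 1
  | .inr (.inl _) => 1
  | .inr (.inr _) => 1 / 2

lemma sum_iv_eq {n : ℕ} (i : Fin n) : ∑ k, iv (k = i) = 1 := by simp [iv]
lemma sum_iv_eq' {n : ℕ} (i : Fin n) : ∑ k, iv (i = k) = 1 := by simp [iv]
lemma sum_iv_mem {n : ℕ} (T : Finset (Fin n)) : ∑ k, iv (k ∈ T) = T.card := by simp [iv]

lemma u23_lin {n : ℕ} (i j k l : Fin n) (h : i ≠ j) :
    u23 i j k l = 12 * iv (k = i) + 6 * iv (k = j) + 9 * iv (l = i) + 3 * iv (l = j) := by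
  unfold u23 iv
  by_cases h1 : k = i <;> by_cases h2 : k = j <;> by_cases h3 : l = i <;> by_cases h4 : l = j <;>
    grind

lemma card_inter_iv {n : ℕ} (T S : Finset (Fin n)) :
    ((T ∩ S).card : ℝ) = ∑ i ∈ T, iv (i ∈ S) := by
  simp [iv, Finset.filter_mem_eq_inter]

lemma u33_lin {n : ℕ} (i j k l : Fin n) (h : i ≠ j) :
    u33 i j k l = 6 * iv (k = i) + 3 * iv (k = j) + 3 * iv (l = i) + 3 * iv (l = j) := by
  unfold u33
  rw [card_inter_iv, Finset.sum_pair h]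
  unfold iv
  by_cases h1 : k = i <;> by_cases h2 : k = j <;> by_cases h3 : l = i <;> by_cases h4 : l = j <;>
    grind

lemma u33_diag {n : ℕ} (i k l : Fin n) :
    u33 i i k l = 9 * iv (k = i) + 6 * iv (l = i) := by
  unfold u33 iv
  by_cases h1 : k = i <;> by_cases h3 : l = i <;> grind

lemma sum_I2 {n : ℕ} (f : Fin n → Fin n → ℝ) :
    ∑ b : I2 n, f b.1.1 b.1.2 = ∑ i, ∑ j, f i j - ∑ i, f i i := by
  rw [← Finset.sum_subtype (Finset.univ.filter fun p : Fin n × Fin n => p.1 ≠ p.2)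
    (by simp) (fun p => f p.1 p.2), Finset.sum_filter, Fintype.sum_prod_type,
    ← Finset.sum_sub_distrib]
  refine Finset.sum_congr rfl fun i _ => ?_
  rw [eq_sub_iff_add_eq, ← Fintype.sum_ite_eq i (fun j => f i j), ← Finset.sum_add_distrib]
  refine Finset.sum_congr rfl fun j _ => ?_
  by_cases h : i = j <;> simp [h]

lemma sum_I1 {n : ℕ} (f : Finset (Fin n) → Fin n → ℝ) :
    ∑ b : I1 n, f b.1.1 b.1.2 = ∑ T ∈ Finset.powersetCard 3 Finset.univ, ∑ l ∈ T, f T l := by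
  rw [← Finset.sum_subtype
    (Finset.univ.filter fun p : Finset (Fin n) × Fin n => p.1.card = 3 ∧ p.2 ∈ p.1)
    (by simp) (fun p => f p.1 p.2)]
  rw [Finset.sum_sigma']
  refine Finset.sum_bij' (fun p _ => ⟨p.1, p.2⟩) (fun p _ => (p.1, p.2)) ?_ ?_ ?_ ?_ ?_ <;>
    simp

lemma count_mem {n : ℕ} (hn : 3 ≤ n) (i : Fin n) :
    ∑ T ∈ Finset.powersetCard 3 (Finset.univ : Finset (Fin n)), iv (i ∈ T)
      = ((n : ℝ) - 1) * (n - 2) / 2 := by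
  have h0 : ((Finset.powersetCard 3 (Finset.univ : Finset (Fin n))).filter (fun T => i ∉ T))
      = Finset.powersetCard 3 (Finset.univ.erase i) := by
    ext T
    simp only [Finset.mem_filter, Finset.mem_powersetCard, Finset.subset_erase]
    tauto
  have h1 := Finset.card_filter_add_card_filter_not
    (s := Finset.powersetCard 3 (Finset.univ : Finset (Fin n))) (fun T => i ∈ T)
  rw [h0] at h1
  simp only [Finset.card_powersetCard, Finset.card_erase_of_mem (Finset.mem_univ i),
    Finset.card_univ, Fintype.card_fin] at h1
  obtain ⟨m, rfl⟩ : ∃ m, n = m + 1 := ⟨n - 1, by omega⟩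
  rw [Nat.choose_succ_succ' m 2, Nat.add_sub_cancel] at h1
  norm_num at h1
  have h2 : (Finset.card ((Finset.powersetCard 3 (Finset.univ : Finset (Fin (m+1)))).filter
    (fun T => i ∈ T))) = m.choose 2 := by omega
  simp only [iv, Finset.sum_boole]
  rw [h2, Nat.cast_choose_two]
  push_cast
  ring

lemma sum_I1_mem {n : ℕ} (hn : 3 ≤ n) (i : Fin n) :
    ∑ b : I1 n, iv (i ∈ b.1.1) = 3 * (((n : ℝ) - 1) * (n - 2) / 2) := by
  rw [sum_I1 (fun T _ => iv (i ∈ T)), ← count_mem hn i, Finset.mul_sum]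
  refine Finset.sum_congr rfl fun T hT => ?_
  rw [Finset.sum_const, (Finset.mem_powersetCard.1 hT).2]
  simp

lemma sum_I1_eq {n : ℕ} (hn : 3 ≤ n) (i : Fin n) :
    ∑ b : I1 n, iv (i = b.1.2) = ((n : ℝ) - 1) * (n - 2) / 2 := by
  rw [sum_I1 (fun _ l => iv (i = l)), ← count_mem hn i]
  refine Finset.sum_congr rfl fun T hT => ?_
  simp [iv]

/-- vEig is an eigenvector of U with eigenvalue d = 15n(2n-1). -/
theorem matU_eigenvector_d (n : ℕ) (hn : 3 ≤ n) :
    matU n *ᵥ vEig n = (15 * (n : ℝ) * (2 * (n : ℝ) - 1)) • vEig n := by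
  funext x
  simp only [Matrix.mulVec, dotProduct, Fintype.sum_sum_type, Pi.smul_apply, smul_eq_mul]
  rcases x with ⟨⟨T, l⟩, hT, hl⟩ | ⟨⟨i, j⟩, hij⟩ | ⟨i, j⟩
  · simp only [matU, vEig, Matrix.of_apply, mul_one, ← Finset.sum_mul]
    have e1 : ∑ b : I1 n, u11 T l b.1.1 b.1.2 = 60 * (((n : ℝ) - 1) * (n - 2) / 2) := by
      simp only [u11, card_inter_iv, ← Finset.mul_sum, Finset.sum_add_distrib]
      rw [Finset.sum_comm, sum_I1_eq hn]
      simp only [sum_I1_mem hn, Finset.sum_const, hT]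
      simp only [nsmul_eq_mul]
      push_cast
      ring
    have e3 : ∑ b : I3 n, u13 T l b.1 b.2 = ∑ i, ∑ j, u13 T l i j := Fintype.sum_prod_type _
    rw [e1, sum_I2 (fun i j => u12 T l i j), e3]
    simp only [u12, u13, Finset.sum_add_distrib, ← Finset.mul_sum, sum_iv_eq, sum_iv_mem, hT,
      Finset.sum_const, Finset.card_univ, Fintype.card_fin, nsmul_eq_mul]
    push_cast
    ring
  · simp only [matU, vEig, Matrix.of_apply, mul_one, ← Finset.sum_mul]
    simp only [ne_eq] at hij
    rw [sum_I2 (fun k l => u22 i j k l), Fintype.sum_prod_type]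
    simp only [u12, u22, u23_lin i j _ _ hij, Finset.sum_add_distrib, ← Finset.mul_sum, sum_iv_eq,
      sum_iv_eq', sum_I1_mem hn, sum_I1_eq hn,
      Finset.sum_const, Finset.card_univ, Fintype.card_fin, nsmul_eq_mul]
    ring
  · simp only [matU, vEig, Matrix.of_apply, mul_one, ← Finset.sum_mul]
    have e2 : ∑ b : I2 n, u23 b.1.1 b.1.2 i j =
        ∑ b : I2 n, (12 * iv (i = b.1.1) + 6 * iv (i = b.1.2) + 9 * iv (j = b.1.1)
          + 3 * iv (j = b.1.2)) :=
      Finset.sum_congr rfl fun b _ => u23_lin _ _ _ _ b.2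
    rw [e2, sum_I2 (fun k l => 12 * iv (i = k) + 6 * iv (i = l) + 9 * iv (j = k)
          + 3 * iv (j = l)), Fintype.sum_prod_type]
    by_cases hij : i = j
    · subst hij
      simp only [u13, u33_diag, Finset.sum_add_distrib, ← Finset.mul_sum, sum_iv_eq,
        sum_iv_eq', sum_I1_mem hn, sum_I1_eq hn,
        Finset.sum_const, Finset.card_univ, Fintype.card_fin, nsmul_eq_mul]
      ring
    · simp only [u13, u33_lin i j _ _ hij, Finset.sum_add_distrib, ← Finset.mul_sum, sum_iv_eq,
        sum_iv_eq', sum_I1_mem hn, sum_I1_eq hn,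
        Finset.sum_const, Finset.card_univ, Fintype.card_fin, nsmul_eq_mul]
      ring
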